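/- Let L : ℕ → ℕ be a nondecreasing unbounded function satisfying L(n+1) ≥ 64·L(n) + 29 for all n ∈ ℕ, for each n let p_n be the smallest prime with L(n) < (p_n − 1)/3, and let W_n := { w ∈ F_2 : w ≠ 1, |w| < (p_n − 1)/3 }. Then for every n ∈ ℕ there exists a nontrivial law w̄_n ∈ F_2 for the group ⊕_{i=1}^n PSL_2(p_i)^{W_i} with |w̄_n| < 3072·L(n) + 1408. -/

import Mathlib

/-- The length of the reduced word representing an element of the free group. -/
def wordLen {k : ℕ} (w : FreeGroup (Fin k)) : ℕ := w.toWord.length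

/-- `w ∈ F_k` is a law for `Γ` if it vanishes under every evaluation in `Γ`. -/
def IsLaw (Γ : Type*) [Group Γ] {k : ℕ} (w : FreeGroup (Fin k)) : Prop :=
  ∀ g : Fin k → Γ, FreeGroup.lift g w = 1

/-- `SL₂(𝔽_p)`. -/
abbrev SL2 (p : ℕ) : Type := Matrix.SpecialLinearGroup (Fin 2) (ZMod p)

/-- `PSL₂(p)`, the quotient of `SL₂(𝔽_p)` by its center. -/
abbrev PSL2 (p : ℕ) : Type := SL2 p ⧸ Subgroup.center (SL2 p)

/-- `W_n = {w ∈ F₂ : w ≠ 1, |w| < (P n − 1)/3}` (for naturals, `|w| < (P n − 1)/3` is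
equivalent to `3|w| + 1 < P n`). -/
abbrev Wset (P : ℕ → ℕ) (n : ℕ) : Type :=
  {w : FreeGroup (Fin 2) // w ≠ 1 ∧ 3 * wordLen w + 1 < P n}

/-- The direct sum `⊕_{i=1}^n PSL₂(P i)^{W_i}` (a finite direct product). -/
abbrev SumGrp (P : ℕ → ℕ) (n : ℕ) : Type :=
  ∀ i : Fin n, Wset P (i.1 + 1) → PSL2 (P (i.1 + 1))

namespace FreeGroup

open scoped commutatorElement

theorem isReduced_invRev {α : Type*} {l : List (α × Bool)} (h : IsReduced l) :
    IsReduced (invRev l) := by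
  classical
  rw [isReduced_iff_reduce_eq] at h ⊢
  rw [reduce_invRev, h]

theorem exists_letter_avoiding (a b : Fin 2 × Bool) :
    ∃ c : Fin 2 × Bool, (b.1 = c.1 → b.2 = c.2) ∧ (a.1 = c.1 → (!a.2) = c.2) := by
  decide +revert

theorem exists_letter_following (c a b : Fin 2 × Bool) :
    ∃ d : Fin 2 × Bool, (c.1 = d.1 → c.2 = d.2) ∧ (d.1 = a.1 → d.2 = a.2) ∧
      (d.1 = b.1 → d.2 = !b.2) := by
  decide +revert

/-- Any two nontrivial elements of `F₂` fail to commute after conjugating one of them by a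
suitable word of length two. -/
theorem exists_commutator_conj_ne_one {u v : FreeGroup (Fin 2)} (hu : u ≠ 1) (hv : v ≠ 1) :
    ∃ z : FreeGroup (Fin 2), z.norm ≤ 2 ∧ ⁅u, z * v * z⁻¹⁆ ≠ 1 := by
  have hul : u.toWord ≠ [] := by simpa using hu
  have hvl : v.toWord ≠ [] := by simpa using hv
  have hur : IsReduced u.toWord := isReduced_toWord
  have hvr : IsReduced v.toWord := isReduced_toWord
  obtain ⟨u₀, hu₀⟩ : ∃ a, u.toWord.head? = some a := ⟨_, List.head?_eq_some_head hul⟩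
  obtain ⟨u₁, hu₁⟩ : ∃ a, u.toWord.getLast? = some a := ⟨_, List.getLast?_eq_some_getLast hul⟩
  obtain ⟨v₀, hv₀⟩ : ∃ a, v.toWord.head? = some a := ⟨_, List.head?_eq_some_head hvl⟩
  obtain ⟨v₁, hv₁⟩ : ∃ a, v.toWord.getLast? = some a := ⟨_, List.getLast?_eq_some_getLast hvl⟩
  obtain ⟨c, hc₁, hc₀⟩ := exists_letter_avoiding u₀ u₁
  obtain ⟨d, hcd, hd₀, hd₁⟩ := exists_letter_following c v₀ v₁
  refine ⟨mk [c, d], norm_mk_le, ?_⟩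
  have hword : ⁅u, mk [c, d] * v * (mk [c, d])⁻¹⁆ =
      mk (u.toWord ++ ([c, d] ++ (v.toWord ++ (invRev [c, d] ++ (invRev u.toWord ++
        ([c, d] ++ (invRev v.toWord ++ invRev [c, d]))))))) := by
    simp only [← mul_mk, ← inv_mk, mk_toWord, commutatorElement_def]
    group
  have hred : IsReduced (u.toWord ++ ([c, d] ++ (v.toWord ++ (invRev [c, d] ++
      (invRev u.toWord ++ ([c, d] ++ (invRev v.toWord ++ invRev [c, d]))))))) := by
    have hui := isReduced_invRev hur
    have hvi := isReduced_invRev hvr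
    have hui₀ : (invRev u.toWord).head? = some (u₁.1, !u₁.2) := by simp [invRev, hu₁]
    have hui₁ : (invRev u.toWord).getLast? = some (u₀.1, !u₀.2) := by simp [invRev, hu₀]
    have hvi₀ : (invRev v.toWord).head? = some (v₁.1, !v₁.2) := by simp [invRev, hv₁]
    have hvi₁ : (invRev v.toWord).getLast? = some (v₀.1, !v₀.2) := by simp [invRev, hv₀]
    have hcdi : invRev [c, d] = [(d.1, !d.2), (c.1, !c.2)] := by simp [invRev]
    rw [hcdi]
    unfold IsReduced at *
    simp only [List.isChain_append, List.head?_append, List.isChain_cons_cons,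
      List.isChain_singleton, hu₁, hv₀, hv₁, hui₀, hui₁, hvi₀, hvi₁, hur, hvr, hui, hvi,
      List.head?_cons, List.getLast?_cons_cons, List.getLast?_singleton, Option.mem_def,
      Option.some.injEq, Option.some_or, forall_eq', true_and, and_true]
    grind
  rw [hword, Ne, ← toWord_eq_nil_iff, toWord_mk, hred.reduce_eq]
  simp [hul]

theorem norm_commutatorElement_le {α : Type*} [DecidableEq α] (u v : FreeGroup α) :
    norm ⁅u, v⁆ ≤ 2 * (norm u + norm v) := by
  rw [commutatorElement_def]
  have h₁ := norm_mul_le (u * v * u⁻¹) v⁻¹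
  have h₂ := norm_mul_le (u * v) u⁻¹
  have h₃ := norm_mul_le u v
  rw [norm_inv_eq] at h₁ h₂
  omega

/-- Two nontrivial words can be combined into a nontrivial word which vanishes whenever
one of them does. -/
theorem exists_combined_word {u v : FreeGroup (Fin 2)} (hu : u ≠ 1) (hv : v ≠ 1) :
    ∃ w : FreeGroup (Fin 2), w ≠ 1 ∧ w.norm ≤ 2 * (u.norm + v.norm + 4) ∧
      ∀ {Γ : Type} [Group Γ] (f : FreeGroup (Fin 2) →* Γ), f u = 1 ∨ f v = 1 → f w = 1 := by
  obtain ⟨z, hz, hne⟩ := exists_commutator_conj_ne_one hu hv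
  refine ⟨_, hne, ?_, ?_⟩
  · have h₁ := norm_commutatorElement_le u (z * v * z⁻¹)
    have h₂ := norm_mul_le (z * v) z⁻¹
    have h₃ := norm_mul_le z v
    rw [norm_inv_eq] at h₂
    omega
  · rintro Γ _ f (h | h) <;> simp [map_commutatorElement, h]

end FreeGroup

open Polynomial in
/-- The `p`-th power of an element of `SL₂(𝔽_p)` is the element itself, its inverse, or
central. -/
theorem SL2.pow_card_eq {p : ℕ} [Fact p.Prime] (x : SL2 p) :
    x ^ p = x ∨ x ^ p = x⁻¹ ∨ x ^ p ∈ Subgroup.center (SL2 p) := by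
  have hp : p.Prime := Fact.out
  set A : Matrix (Fin 2) (Fin 2) (ZMod p) := x.1 with hA
  set t := A.trace with ht
  set f : (ZMod p)[X] := X ^ 2 - C t * X + 1 with hf
  have hch : A.charpoly = f := by
    rw [Matrix.charpoly_fin_two, hA, x.det_coe, hf, ht, hA, C_1]
  have hfA : aeval A f = 0 := by rw [← hch, Matrix.aeval_self_charpoly]
  have hzero : ∀ g : (ZMod p)[X], f ∣ g → aeval A g = 0 := by
    rintro _ ⟨g, rfl⟩
    rw [map_mul, hfA, zero_mul]
  have hself : f ∣ X ^ p - X → x ^ p = x := by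
    intro h
    have h₁ := hzero _ h
    simp only [map_sub, map_pow, aeval_X, sub_eq_zero] at h₁
    apply Subtype.ext
    simpa [hA] using h₁
  have hdeg : f.natDegree = 2 := by rw [hf]; compute_degree!
  have hmonic : f.Monic := by rw [hf]; monicity!
  by_cases hirr : Irreducible f
  · have hdvd : f ∣ (X ^ p - X) * (X ^ p + X - C t) := by
      have h₁ : f ∣ expand (ZMod p) p f := by
        rw [ZMod.expand_card]
        exact dvd_pow_self _ hp.ne_zero
      have h₂ : (X ^ p - X) * (X ^ p + X - C t) = expand (ZMod p) p f - f := by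
        simp only [hf, map_add, map_sub, map_mul, map_pow, expand_X, expand_C, map_one]
        ring
      rw [h₂]
      exact dvd_sub h₁ dvd_rfl
    rcases hirr.prime.dvd_or_dvd hdvd with h | h
    · exact Or.inl (hself h)
    · refine Or.inr (Or.inl ?_)
      have h₁ := hzero _ h
      simp only [map_sub, map_add, map_pow, aeval_X, aeval_C] at h₁
      rw [eq_inv_iff_mul_eq_one]
      apply Subtype.ext
      have h₂ : A ^ p = algebraMap _ _ t - A := by
        rw [eq_sub_iff_add_eq]
        exact sub_eq_zero.mp h₁
      have h₃ := hfA
      simp only [hf, map_sub, map_add, map_mul, map_pow, aeval_X, aeval_C, map_one] at h₃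
      have h₄ : A ^ p * A = 1 := by
        rw [h₂, sub_mul, ← sub_eq_zero, ← neg_eq_zero, ← h₃]
        noncomm_ring
      simpa [hA] using h₄
  · rw [hmonic.irreducible_iff_roots_eq_zero_of_degree_le_three hdeg.ge (by omega)] at hirr
    obtain ⟨a, ha⟩ := Multiset.exists_mem_of_ne_zero hirr
    rw [mem_roots hmonic.ne_zero, IsRoot.def] at ha
    have ha' : a ^ 2 - t * a + 1 = 0 := by simpa [hf] using ha
    have hfac : f = (X - C a) * (X - C (t - a)) := by
      have h₁ : (1 : (ZMod p)[X]) = C (t * a - a ^ 2) := by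
        rw [← C_1]; congr 1; linear_combination ha'
      rw [hf, h₁]
      simp only [C_sub, C_mul, C_pow]
      ring
    have hlin : ∀ b : ZMod p, X - C b ∣ X ^ p - X := fun b ↦ by
      rw [dvd_iff_isRoot, IsRoot.def]
      simp [ZMod.pow_card]
    by_cases hab : a = t - a
    · refine Or.inr (Or.inr ?_)
      have hsq : (A - algebraMap _ _ a) ^ 2 = 0 := by
        have h₁ := hfA
        rw [hfac, ← hab, ← sq] at h₁
        simpa using h₁
      have hpow : (A - algebraMap _ _ a) ^ p = 0 :=
        pow_eq_zero_of_le hp.two_le hsq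
      rw [sub_pow_char_of_commute (p := p) (Algebra.commutes a A).symm, sub_eq_zero,
        ← map_pow] at hpow
      rw [Subgroup.mem_center_iff]
      intro g
      apply Subtype.ext
      have h₁ : ((x ^ p : SL2 p) : Matrix (Fin 2) (Fin 2) (ZMod p)) = algebraMap _ _ (a ^ p) := by
        simpa [hA] using hpow
      rw [Matrix.SpecialLinearGroup.coe_mul, Matrix.SpecialLinearGroup.coe_mul, h₁]
      exact (Algebra.commutes _ _).symm
    · refine Or.inl (hself ?_)
      rw [hfac]
      exact (isCoprime_X_sub_C_of_isUnit_sub (sub_ne_zero.mpr hab).isUnit).mul_dvd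
        (hlin _) (hlin _)

theorem PSL2.pow_eq_one {p : ℕ} [Fact p.Prime] (x : PSL2 p) :
    (x ^ (p - 1) = 1 ∨ x ^ (p + 1) = 1) ∨ x ^ p = 1 := by
  have hp : p.Prime := Fact.out
  induction x using QuotientGroup.induction_on with
  | H x =>
    rcases SL2.pow_card_eq x with h | h | h
    · refine Or.inl (Or.inl ?_)
      have h₁ : x ^ (p - 1) = 1 := by
        rw [← mul_eq_right (b := x), ← pow_succ, Nat.sub_add_cancel hp.one_le, h]
      rw [← QuotientGroup.mk_pow, h₁, QuotientGroup.mk_one]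
    · refine Or.inl (Or.inr ?_)
      rw [← QuotientGroup.mk_pow, pow_succ, h, inv_mul_cancel, QuotientGroup.mk_one]
    · refine Or.inr ?_
      rwa [← QuotientGroup.mk_pow, QuotientGroup.eq_one_iff]

/-- `PSL₂(p)` has a nontrivial law of length linear in `p`. -/
theorem PSL2.exists_law {p : ℕ} (hp : p.Prime) :
    ∃ w : FreeGroup (Fin 2), w ≠ 1 ∧ IsLaw (PSL2 p) w ∧ w.norm ≤ 10 * p + 24 := by
  have : Fact p.Prime := ⟨hp⟩
  have hne : ∀ k : ℕ, k ≠ 0 → (FreeGroup.of (0 : Fin 2)) ^ k ≠ 1 := fun k hk ↦ by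
    rw [Ne, ← FreeGroup.norm_eq_zero, FreeGroup.norm_of_pow]
    exact hk
  obtain ⟨u, hu, hul, huv⟩ := FreeGroup.exists_combined_word
    (hne (p - 1) (Nat.sub_ne_zero_of_lt hp.one_lt)) (hne (p + 1) p.succ_ne_zero)
  obtain ⟨w, hw, hwl, hwv⟩ := FreeGroup.exists_combined_word hu (hne p hp.ne_zero)
  refine ⟨w, hw, fun g ↦ hwv (FreeGroup.lift g) ?_, ?_⟩
  · refine (PSL2.pow_eq_one (g 0)).imp (fun h ↦ huv (FreeGroup.lift g) ?_) fun h ↦ ?_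
    · simpa using h
    · simpa using h
  · simp only [FreeGroup.norm_of_pow] at hul hwl
    have := hp.one_le
    omega

theorem IsLaw.pi {ι : Type*} {G : ι → Type*} [∀ i, Group (G i)] {k : ℕ}
    {w : FreeGroup (Fin k)} (h : ∀ i, IsLaw (G i) w) : IsLaw (∀ i, G i) w := by
  intro g
  ext i
  have h₁ : (Pi.evalMonoidHom G i).comp (FreeGroup.lift g) = FreeGroup.lift fun j ↦ g j i := by
    ext j
    simp
  exact (DFunLike.congr_fun h₁ w).trans (h i _)

theorem exists_common_law (L P : ℕ → ℕ) (hL64 : ∀ n : ℕ, 1 ≤ n → 64 * L n + 29 ≤ L (n + 1))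
    (hprime : ∀ n : ℕ, 1 ≤ n → (P n).Prime) (hP : ∀ n : ℕ, 1 ≤ n → P n ≤ 6 * L n + 2)
    (n : ℕ) (hn : 1 ≤ n) :
    ∃ w : FreeGroup (Fin 2), w ≠ 1 ∧ (∀ i, 1 ≤ i → i ≤ n → IsLaw (PSL2 (P i)) w) ∧
      w.norm < 3072 * L n + 1408 := by
  induction n, hn using Nat.le_induction with
  | base =>
    obtain ⟨w, hw, hlaw, hlen⟩ := PSL2.exists_law (hprime 1 le_rfl)
    refine ⟨w, hw, fun i h₁ h₂ ↦ ?_, ?_⟩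
    · rwa [le_antisymm h₂ h₁]
    · have := hP 1 le_rfl
      omega
  | succ n hn ih =>
    obtain ⟨v, hv, hvlaw, hvlen⟩ := ih
    obtain ⟨u, hu, hulaw, hulen⟩ := PSL2.exists_law (hprime (n + 1) (by omega))
    obtain ⟨w, hw, hwlen, hwlaw⟩ := FreeGroup.exists_combined_word hu hv
    refine ⟨w, hw, fun i h₁ h₂ g ↦ hwlaw (FreeGroup.lift g) ?_, ?_⟩
    · rcases h₂.eq_or_lt with rfl | h₃
      · exact Or.inl (hulaw g)
      · exact Or.inr (hvlaw i h₁ (Nat.le_of_lt_succ h₃) g)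
    · have := hP (n + 1) (by omega)
      have := hL64 n hn
      omega

/-- With `P n` the smallest prime where `L n < (P n − 1)/3`, if moreover
`L(n+1) ≥ 64·L(n) + 29` for all `n ≥ 1`, then for every `n ≥ 1` there is a nontrivial law
`w̄_n ∈ F₂` for `⊕_{i=1}^n PSL₂(P i)^{W_i}` of length less than `3072·L(n) + 1408`. -/
theorem stmt13 (L : ℕ → ℕ)
    (hLmono : ∀ ⦃m n : ℕ⦄, 1 ≤ m → m ≤ n → L m ≤ L n)
    (hLunb : ∀ N : ℕ, ∃ n : ℕ, 1 ≤ n ∧ N ≤ L n)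
    (hL64 : ∀ n : ℕ, 1 ≤ n → 64 * L n + 29 ≤ L (n + 1))
    (P : ℕ → ℕ)
    (hP : ∀ n : ℕ, 1 ≤ n → (P n).Prime ∧ 3 * L n + 1 < P n ∧
      ∀ r : ℕ, r.Prime → 3 * L n + 1 < r → P n ≤ r) :
    ∀ n : ℕ, 1 ≤ n → ∃ w : FreeGroup (Fin 2),
      w ≠ 1 ∧ IsLaw (SumGrp P n) w ∧ wordLen w < 3072 * L n + 1408 := by
  intro n hn
  have hP6 : ∀ m : ℕ, 1 ≤ m → P m ≤ 6 * L m + 2 := fun m hm ↦ by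
    obtain ⟨r, hr, hlt, hle⟩ := Nat.exists_prime_lt_and_le_two_mul (3 * L m + 1) (by omega)
    have := (hP m hm).2.2 r hr hlt
    omega
  obtain ⟨w, hw, hlaw, hlen⟩ := exists_common_law L P hL64 (fun m hm ↦ (hP m hm).1) hP6 n hn
  exact ⟨w, hw, IsLaw.pi fun i ↦ IsLaw.pi fun _ ↦ hlaw _ (by omega) (by omega), hlen⟩
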